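/- Spectral-norm bound for sampled approximation of A·Aᵀ: suppose ‖A‖₂ ≤ 1 and ‖A‖_F² ≥ 1/24, let β ∈ (0,1], ε ∈ (0,1), δ ∈ (0,1), assume the sampling probabilities satisfy q i ≥ β·‖A^(i)‖²/‖A‖_F² for every i, and assume the number of samples satisfies (c : ℝ) ≥ (96·‖A‖_F²/(β·ε²))·log(96·‖A‖_F²/(β·ε²·√δ)). Then μ{ω : ‖A·Aᵀ − C(ω)·C(ω)ᵀ‖₂ ≤ ε} ≥ 1 − δ. -/

import Mathlib

open MeasureTheory Matrix

/-- Frobenius norm of a real matrix. -/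
noncomputable def frobNorm {m p : ℕ} (M : Matrix (Fin m) (Fin p) ℝ) : ℝ :=
  Real.sqrt (∑ i, ∑ j, (M i j) ^ 2)

/-- Euclidean norm of a vector. -/
noncomputable def vecNorm {m : ℕ} (v : Fin m → ℝ) : ℝ :=
  Real.sqrt (∑ i, (v i) ^ 2)

/-- Spectral norm (`ℓ₂ → ℓ₂` operator norm, largest singular value) of a real matrix. -/
noncomputable def specNorm {m n : ℕ} (M : Matrix (Fin m) (Fin n) ℝ) : ℝ :=
  ‖(Matrix.toEuclideanLin M).toContinuousLinearMap‖

/-- The sampled-column matrix `C(ω)`, whose `t`-th column is `(c·q(ω t))^{-1/2} • A^{(ω t)}`. -/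
noncomputable def Csample {m n c : ℕ} (A : Matrix (Fin m) (Fin n) ℝ)
    (q : Fin n → ℝ) (ω : Fin c → Fin n) : Matrix (Fin m) (Fin c) ℝ :=
  Matrix.of fun i t => A i (ω t) / Real.sqrt ((c : ℝ) * q (ω t))

open Filter Topology

section LieTrotter

variable {𝔸 : Type*} [NormedRing 𝔸] [NormedAlgebra ℝ 𝔸] [NormOneClass 𝔸] [CompleteSpace 𝔸]

theorem norm_exp_le_exp_norm (x : 𝔸) : ‖NormedSpace.exp x‖ ≤ Real.exp ‖x‖ := by
  have h := NormedSpace.exp_series_hasSum_exp' (𝕂 := ℝ) x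
  have h2 := NormedSpace.exp_series_hasSum_exp' (𝕂 := ℝ) ‖x‖
  rw [← Real.exp_eq_exp_ℝ] at h2
  refine h.norm_le_of_bounded h2 fun k => ?_
  rw [norm_smul, smul_eq_mul, Real.norm_of_nonneg (by positivity)]
  gcongr
  exact norm_pow_le x k

theorem norm_pow_sub_pow_le {R : Type*} [NormedRing R] [NormOneClass R] {x y : R} {K : ℝ}
    (hK : 1 ≤ K) (hx : ‖x‖ ≤ K) (hy : ‖y‖ ≤ K) (k : ℕ) : ‖x ^ k - y ^ k‖ ≤ k * K ^ k * ‖x - y‖ := by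
  induction k with
  | zero => simp
  | succ k ih =>
    have e : x ^ (k + 1) - y ^ (k + 1) = x ^ k * (x - y) + (x ^ k - y ^ k) * y := by
      noncomm_ring
    have h1 : ‖x ^ k * (x - y)‖ ≤ K ^ k * ‖x - y‖ :=
      (norm_mul_le _ _).trans <| by
        gcongr
        exact (norm_pow_le x k).trans (by gcongr)
    have h2 : ‖(x ^ k - y ^ k) * y‖ ≤ k * K ^ k * ‖x - y‖ * K :=
      (norm_mul_le _ _).trans (mul_le_mul ih hy (norm_nonneg _) (by positivity))
    have h3 : K ^ k * ‖x - y‖ ≤ K ^ k * ‖x - y‖ * K := le_mul_of_one_le_right (by positivity) hK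
    calc _ ≤ _ := by rw [e]; exact norm_add_le (x ^ k * (x - y)) ((x ^ k - y ^ k) * y)
      _ ≤ K ^ k * ‖x - y‖ * K + k * K ^ k * ‖x - y‖ * K := add_le_add (h1.trans h3) h2
      _ = _ := by push_cast; ring

/-- The Lie–Trotter product formula. -/
theorem tendsto_exp_mul_exp_pow (a b : 𝔸) :
    Tendsto (fun k : ℕ => (NormedSpace.exp ((k : ℝ)⁻¹ • a) * NormedSpace.exp ((k : ℝ)⁻¹ • b)) ^ k)
      atTop (𝓝 (NormedSpace.exp (a + b))) := by
  let _ : NormedAlgebra ℚ 𝔸 := NormedAlgebra.restrictScalars ℚ ℝ 𝔸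
  set f : ℝ → 𝔸 := fun t =>
    NormedSpace.exp (t • a) * NormedSpace.exp (t • b) - NormedSpace.exp (t • (a + b)) with hf
  have hd : HasDerivAt f 0 0 := by
    have h := ((hasDerivAt_exp_smul_const (𝕂 := ℝ) a (0 : ℝ)).mul
      (hasDerivAt_exp_smul_const (𝕂 := ℝ) b (0 : ℝ))).sub
      (hasDerivAt_exp_smul_const (𝕂 := ℝ) (a + b) (0 : ℝ))
    exact HasDerivAt.congr_deriv (f := f) h (by simp [NormedSpace.exp_zero])
  have hinv : Tendsto (fun k : ℕ => (k : ℝ)⁻¹) atTop (𝓝[≠] 0) := by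
    refine tendsto_nhdsWithin_iff.2 ⟨tendsto_inv_atTop_nhds_zero_nat, ?_⟩
    filter_upwards [eventually_gt_atTop 0] with k hk
    simp [hk.ne']
  have hlim : Tendsto (fun k : ℕ => Real.exp (‖a‖ + ‖b‖) * ‖(k : ℝ) • f (k : ℝ)⁻¹‖) atTop (𝓝 0) := by
    have h := ((hd.tendsto_slope_zero.comp hinv).norm).const_mul (Real.exp (‖a‖ + ‖b‖))
    simpa [Function.comp_def, hf, NormedSpace.exp_zero] using h
  rw [tendsto_iff_norm_sub_tendsto_zero]
  refine squeeze_zero' (Eventually.of_forall fun _ => norm_nonneg _) ?_ hlim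
  filter_upwards [eventually_gt_atTop 0] with k hk
  have hk0 : (k : ℝ) ≠ 0 := by positivity
  have hn : ∀ c : 𝔸, ‖(k : ℝ)⁻¹ • c‖ = (k : ℝ)⁻¹ * ‖c‖ := fun c => by
    rw [norm_smul, Real.norm_of_nonneg (by positivity)]
  set K := Real.exp ((k : ℝ)⁻¹ * (‖a‖ + ‖b‖)) with hKdef
  have hx : ‖NormedSpace.exp ((k : ℝ)⁻¹ • a) * NormedSpace.exp ((k : ℝ)⁻¹ • b)‖ ≤ K := by
    rw [hKdef, mul_add, Real.exp_add, ← hn, ← hn]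
    refine (norm_mul_le _ _).trans ?_
    gcongr <;> exact norm_exp_le_exp_norm _
  have hy : ‖NormedSpace.exp ((k : ℝ)⁻¹ • (a + b))‖ ≤ K := by
    refine (norm_exp_le_exp_norm _).trans ?_
    rw [hn, hKdef]
    gcongr
    exact norm_add_le a b
  have hKk : K ^ k = Real.exp (‖a‖ + ‖b‖) := by
    rw [hKdef, ← Real.exp_nat_mul]
    congr 1
    field_simp
  have hexp : NormedSpace.exp (a + b) = NormedSpace.exp ((k : ℝ)⁻¹ • (a + b)) ^ k := by
    rw [← NormedSpace.exp_nsmul, ← Nat.cast_smul_eq_nsmul ℝ, smul_smul, mul_inv_cancel₀ hk0, one_smul]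
  have h := norm_pow_sub_pow_le (Real.one_le_exp (by positivity)) hx hy k
  rw [← hexp, hKk] at h
  rw [norm_smul, Real.norm_of_nonneg k.cast_nonneg]
  exact h.trans_eq (by ring)

end LieTrotter

namespace Matrix

theorem two_mul_trace_mul_le {n : Type*} [Fintype n] (P Q : Matrix n n ℝ) :
    2 * trace (P * Qᴴ) ≤ trace (P * Pᴴ) + trace (Q * Qᴴ) := by
  have h := (posSemidef_self_mul_conjTranspose (P - Q)).trace_nonneg
  have e : trace (Q * Pᴴ) = trace (P * Qᴴ) := by
    rw [← star_trivial (trace (P * Qᴴ)), ← trace_conjTranspose, conjTranspose_mul,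
      conjTranspose_conjTranspose]
  simp only [conjTranspose_sub, sub_mul, mul_sub, trace_sub, e] at h
  linarith

theorem posSemidef_vecMulVec_self {n : Type*} [Fintype n] (x : n → ℝ) :
    (vecMulVec x x).PosSemidef := by
  simpa using posSemidef_vecMulVec_self_star x

variable {n : Type*} [Fintype n] [DecidableEq n]

theorem trace_mul_pow_comm {R : Type*} [CommRing R] (X Y : Matrix n n R) (k : ℕ) :
    trace ((X * Y) ^ k) = trace ((Y * X) ^ k) := by
  cases k with
  | zero => simp
  | succ k =>
    have h : ∀ k : ℕ, (X * Y) ^ (k + 1) = X * ((Y * X) ^ k * Y) := fun k => by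
      induction k with
      | zero => simp
      | succ k ih => rw [pow_succ', ih, pow_succ']; simp only [mul_assoc]
    rw [h, trace_mul_comm, mul_assoc, ← pow_succ]

theorem trace_pow_two_pow_le (k : ℕ) :
    (∀ M : Matrix n n ℝ, trace (M ^ 2 ^ (k + 1)) ≤ trace ((M * Mᴴ) ^ 2 ^ k)) ∧
    ∀ P Q : Matrix n n ℝ, P.IsHermitian → Q.IsHermitian →
      trace ((P * Q) ^ 2 ^ k) ≤ trace (P ^ 2 ^ k * Q ^ 2 ^ k) := by
  induction k with
  | zero =>
    refine ⟨fun M => ?_, fun P Q _ _ => by simp⟩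
    have h := two_mul_trace_mul_le M Mᴴ
    rw [conjTranspose_conjTranspose, trace_mul_comm Mᴴ M] at h
    simp only [zero_add, pow_one, pow_zero, pow_two M]
    linarith
  | succ k ih =>
    obtain ⟨ihT, ihU⟩ := ih
    refine ⟨fun M => ?_, fun P Q hP hQ => ?_⟩
    · have hP : (Mᴴ * M).IsHermitian := isHermitian_conjTranspose_mul_self M
      have hQ : (M * Mᴴ).IsHermitian := isHermitian_mul_conjTranspose_self M
      have e : M ^ 2 * (M ^ 2)ᴴ = M * (M * Mᴴ * Mᴴ) := by
        rw [pow_two, conjTranspose_mul]; simp only [mul_assoc]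
      have e2 : M * Mᴴ * Mᴴ * M = (M * Mᴴ) * (Mᴴ * M) := by simp only [mul_assoc]
      have h2 := two_mul_trace_mul_le ((M * Mᴴ) ^ 2 ^ k) ((Mᴴ * M) ^ 2 ^ k)
      rw [(hP.pow _).eq, (hQ.pow _).eq, ← pow_add, ← pow_add, ← two_mul, ← pow_succ',
        trace_mul_pow_comm Mᴴ M] at h2
      calc trace (M ^ 2 ^ (k + 1 + 1)) = trace ((M ^ 2) ^ 2 ^ (k + 1)) := by
            rw [← pow_mul, ← pow_succ']
        _ ≤ trace ((M ^ 2 * (M ^ 2)ᴴ) ^ 2 ^ k) := ihT _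
        _ = trace (((M * Mᴴ) * (Mᴴ * M)) ^ 2 ^ k) := by rw [e, trace_mul_pow_comm, e2]
        _ ≤ _ := ihU _ _ hQ hP
        _ ≤ _ := by linarith
    · have e : P * Q * (P * Q)ᴴ = P * (Q * Q * P) := by
        rw [conjTranspose_mul, hP.eq, hQ.eq]; simp only [mul_assoc]
      have e2 : Q * Q * P * P = Q ^ 2 * P ^ 2 := by simp only [pow_two, mul_assoc]
      calc trace ((P * Q) ^ 2 ^ (k + 1)) ≤ _ := ihT _
        _ = trace ((P ^ 2 * Q ^ 2) ^ 2 ^ k) := by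
          rw [e, trace_mul_pow_comm, e2, trace_mul_pow_comm]
        _ ≤ _ := ihU _ _ (hP.pow 2) (hQ.pow 2)
        _ = _ := by rw [← pow_mul, ← pow_mul, ← pow_succ']

open scoped Matrix.Norms.L2Operator in
/-- The Golden–Thompson inequality for real symmetric matrices. -/
theorem IsHermitian.trace_exp_add_le [Nonempty n] {A B : Matrix n n ℝ} (hA : A.IsHermitian)
    (hB : B.IsHermitian) :
    trace (NormedSpace.exp (A + B)) ≤ trace (NormedSpace.exp A * NormedSpace.exp B) := by
  have : NormOneClass (Matrix n n ℝ) := ⟨CStarRing.norm_one⟩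
  have hlim := ((continuous_id.matrix_trace (n := n) (R := ℝ)).tendsto _).comp
    ((tendsto_exp_mul_exp_pow A B).comp (tendsto_pow_atTop_atTop_of_one_lt one_lt_two))
  refine le_of_tendsto hlim (Eventually.of_forall fun k => ?_)
  have hs : ∀ {C : Matrix n n ℝ}, C.IsHermitian →
      (NormedSpace.exp (((2 ^ k : ℕ) : ℝ)⁻¹ • C)).IsHermitian := fun {C} hC =>
    IsHermitian.exp (hC.smul (IsSelfAdjoint.all _))
  have hp : ∀ C : Matrix n n ℝ,
      NormedSpace.exp (((2 ^ k : ℕ) : ℝ)⁻¹ • C) ^ 2 ^ k = NormedSpace.exp C := fun C => by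
    rw [← Matrix.exp_nsmul, ← Nat.cast_smul_eq_nsmul ℝ, smul_smul, mul_inv_cancel₀ (by positivity),
      one_smul]
  have h := (trace_pow_two_pow_le k).2 _ _ (hs hA) (hs hB)
  rw [hp, hp] at h
  exact h

theorem IsHermitian.exists_eq_unitary_mul_diagonal {H : Matrix n n ℝ} (hH : H.IsHermitian) :
    ∃ (U : unitaryGroup n ℝ) (d : n → ℝ),
      H = (U : Matrix n n ℝ) * diagonal d * (U : Matrix n n ℝ)ᴴ :=
  ⟨hH.eigenvectorUnitary, hH.eigenvalues, by
    simpa [Unitary.conjStarAlgAut_apply, star_eq_conjTranspose, Function.comp_def]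
      using hH.spectral_theorem⟩

theorem unitary_mul_conjTranspose (U : unitaryGroup n ℝ) :
    (U : Matrix n n ℝ) * (U : Matrix n n ℝ)ᴴ = 1 :=
  Unitary.coe_mul_star_self U

theorem conjTranspose_mul_unitary (U : unitaryGroup n ℝ) :
    (U : Matrix n n ℝ)ᴴ * (U : Matrix n n ℝ) = 1 :=
  Unitary.coe_star_mul_self U

theorem exp_unitary_mul_diagonal (U : unitaryGroup n ℝ) (d : n → ℝ) :
    NormedSpace.exp ((U : Matrix n n ℝ) * diagonal d * (U : Matrix n n ℝ)ᴴ) =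
      (U : Matrix n n ℝ) * diagonal (fun i => Real.exp (d i)) * (U : Matrix n n ℝ)ᴴ := by
  have hU : IsUnit (U : Matrix n n ℝ) := (Unitary.toUnits U).isUnit
  have hinv : (U : Matrix n n ℝ)⁻¹ = (U : Matrix n n ℝ)ᴴ :=
    inv_eq_right_inv (unitary_mul_conjTranspose U)
  have h := exp_conj (U : Matrix n n ℝ) (diagonal d) hU
  rw [hinv, exp_diagonal] at h
  rw [h]
  congr 3
  ext i
  rw [Pi.coe_exp, Real.exp_eq_exp_ℝ]

theorem PosSemidef.trace_mul_nonneg {A B : Matrix n n ℝ} (hA : A.PosSemidef)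
    (hB : B.PosSemidef) : 0 ≤ trace (A * B) := by
  obtain ⟨U, d, rfl⟩ := hA.1.exists_eq_unitary_mul_diagonal
  have hd : ∀ i, 0 ≤ d i := fun i => by
    have h := (hA.conjTranspose_mul_mul_same (U : Matrix n n ℝ)).diag_nonneg (i := i)
    have e : (U : Matrix n n ℝ)ᴴ * ((U : Matrix n n ℝ) * diagonal d * (U : Matrix n n ℝ)ᴴ) * U =
        diagonal d := by
      rw [mul_assoc, mul_assoc, conjTranspose_mul_unitary, mul_one, ← mul_assoc,
        conjTranspose_mul_unitary, one_mul]
    rwa [e, diagonal_apply_eq] at h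
  rw [mul_assoc, mul_assoc, trace_mul_comm, mul_assoc, mul_assoc, ← mul_assoc _ B, trace]
  refine Finset.sum_nonneg fun i _ => ?_
  rw [diag_apply, diagonal_mul]
  exact mul_nonneg (hd i) (hB.conjTranspose_mul_mul_same (U : Matrix n n ℝ)).diag_nonneg

theorem PosSemidef.unitary_mul_diagonal (U : unitaryGroup n ℝ) {d : n → ℝ} (hd : ∀ i, 0 ≤ d i) :
    ((U : Matrix n n ℝ) * diagonal d * (U : Matrix n n ℝ)ᴴ).PosSemidef :=
  (PosSemidef.diagonal hd).mul_mul_conjTranspose_same _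

theorem _root_.Real.exp_le_one_add_add_sq {x : ℝ} (hx : x ≤ 1) : Real.exp x ≤ 1 + x + x ^ 2 := by
  rcases le_total (-1) x with h | h
  · have := (abs_le.1 (Real.abs_exp_sub_one_sub_id_le (abs_le.2 ⟨h, hx⟩))).2
    linarith
  · have := Real.exp_le_one_iff.2 (h.trans (by norm_num : (-1 : ℝ) ≤ 0))
    nlinarith

theorem IsHermitian.posSemidef_one_add_add_sq_sub_exp {X : Matrix n n ℝ} (hX : X.IsHermitian)
    (h1 : (1 - X).PosSemidef) : (1 + X + X ^ 2 - NormedSpace.exp X).PosSemidef := by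
  obtain ⟨U, d, rfl⟩ := hX.exists_eq_unitary_mul_diagonal
  have hd : ∀ i, d i ≤ 1 := fun i => by
    have h := (h1.conjTranspose_mul_mul_same (U : Matrix n n ℝ)).diag_nonneg (i := i)
    have e : (U : Matrix n n ℝ)ᴴ * (1 - (U : Matrix n n ℝ) * diagonal d * (U : Matrix n n ℝ)ᴴ) * U =
        1 - diagonal d := by
      rw [mul_sub, sub_mul, mul_one, mul_assoc, mul_assoc, mul_assoc, conjTranspose_mul_unitary,
        mul_one, ← mul_assoc, conjTranspose_mul_unitary, one_mul]
    rw [e, sub_apply, one_apply_eq, diagonal_apply_eq] at h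
    linarith
  have e : 1 + (U : Matrix n n ℝ) * diagonal d * (U : Matrix n n ℝ)ᴴ +
      ((U : Matrix n n ℝ) * diagonal d * (U : Matrix n n ℝ)ᴴ) ^ 2 -
      NormedSpace.exp ((U : Matrix n n ℝ) * diagonal d * (U : Matrix n n ℝ)ᴴ) =
      (U : Matrix n n ℝ) * diagonal (fun i => 1 + d i + d i ^ 2 - Real.exp (d i)) *
        (U : Matrix n n ℝ)ᴴ := by
    have hsq : ((U : Matrix n n ℝ) * diagonal d * (U : Matrix n n ℝ)ᴴ) ^ 2 =
        (U : Matrix n n ℝ) * diagonal (fun i => d i ^ 2) * (U : Matrix n n ℝ)ᴴ := by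
      rw [pow_two, mul_assoc (_ * _), ← mul_assoc _ (_ * _), ← mul_assoc _ (U : Matrix n n ℝ),
        conjTranspose_mul_unitary, one_mul, ← mul_assoc, mul_assoc (U : Matrix n n ℝ),
        diagonal_mul_diagonal]
      simp only [pow_two]
    rw [exp_unitary_mul_diagonal, hsq, ← diagonal_sub, ← diagonal_add, ← diagonal_add, diagonal_one]
    simp only [mul_sub, mul_add, sub_mul, add_mul, mul_one, unitary_mul_conjTranspose]
  rw [e]
  exact PosSemidef.unitary_mul_diagonal U fun i =>
    sub_nonneg.2 (Real.exp_le_one_add_add_sq (hd i))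

theorem exp_add_exp_neg_sub_two_unitary (U : unitaryGroup n ℝ) (d : n → ℝ) :
    NormedSpace.exp ((U : Matrix n n ℝ) * diagonal d * (U : Matrix n n ℝ)ᴴ) +
      NormedSpace.exp (-((U : Matrix n n ℝ) * diagonal d * (U : Matrix n n ℝ)ᴴ)) - 2 =
      (U : Matrix n n ℝ) * diagonal (fun i => Real.exp (d i) + Real.exp (-d i) - 2) *
        (U : Matrix n n ℝ)ᴴ := by
  have hneg : -((U : Matrix n n ℝ) * diagonal d * (U : Matrix n n ℝ)ᴴ) =
      (U : Matrix n n ℝ) * diagonal (fun i => -d i) * (U : Matrix n n ℝ)ᴴ := by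
    rw [← diagonal_neg, mul_neg, neg_mul]
  have h2 : (2 : Matrix n n ℝ) =
      (U : Matrix n n ℝ) * diagonal (fun _ => 2) * (U : Matrix n n ℝ)ᴴ := by
    have : (diagonal fun _ => 2 : Matrix n n ℝ) = 1 + 1 := by
      rw [one_add_one_eq_two]; exact (diagonal_ofNat 2)
    rw [this, mul_add, add_mul, mul_one, unitary_mul_conjTranspose, one_add_one_eq_two]
  rw [hneg, exp_unitary_mul_diagonal, exp_unitary_mul_diagonal, ← diagonal_sub, ← diagonal_add,
    mul_sub, sub_mul, ← h2, mul_add, add_mul]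

theorem _root_.Real.exp_add_exp_neg_sub_two_nonneg (x : ℝ) :
    0 ≤ Real.exp x + Real.exp (-x) - 2 := by
  have h := Real.one_le_cosh x
  rw [Real.cosh_eq] at h
  linarith

theorem IsHermitian.posSemidef_exp_add_exp_neg_sub_two {H : Matrix n n ℝ} (hH : H.IsHermitian) :
    (NormedSpace.exp H + NormedSpace.exp (-H) - 2).PosSemidef := by
  obtain ⟨U, d, rfl⟩ := hH.exists_eq_unitary_mul_diagonal
  rw [exp_add_exp_neg_sub_two_unitary]
  exact PosSemidef.unitary_mul_diagonal U fun i => Real.exp_add_exp_neg_sub_two_nonneg _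

open scoped Matrix.Norms.L2Operator in
theorem IsHermitian.exp_sub_two_le_trace {H : Matrix n n ℝ} (hH : H.IsHermitian) {a : ℝ}
    (ha : 0 ≤ a) (haH : a < ‖H‖) :
    Real.exp a - 2 ≤ trace (NormedSpace.exp H + NormedSpace.exp (-H) - 2) := by
  obtain ⟨U, d, rfl⟩ := hH.exists_eq_unitary_mul_diagonal
  rw [exp_add_exp_neg_sub_two_unitary, trace_mul_comm, ← mul_assoc, conjTranspose_mul_unitary,
    one_mul, trace_diagonal]
  have hnorm : ‖(U : Matrix n n ℝ) * diagonal d * (U : Matrix n n ℝ)ᴴ‖ = ‖d‖ := by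
    have h := CStarRing.norm_mul_coe_unitary ((U : Matrix n n ℝ) * diagonal d) (star U)
    rw [Unitary.coe_star, star_eq_conjTranspose] at h
    rw [h, CStarRing.norm_coe_unitary_mul, l2_opNorm_diagonal]
  rw [hnorm] at haH
  obtain ⟨i, hi⟩ : ∃ i, a < ‖d i‖ := by
    by_contra! hcon
    exact haH.not_ge ((pi_norm_le_iff_of_nonneg ha).2 hcon)
  refine le_trans ?_ (Finset.single_le_sum
    (fun j _ => Real.exp_add_exp_neg_sub_two_nonneg (d j)) (Finset.mem_univ i))
  rw [Real.norm_eq_abs] at hi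
  rcases abs_choice (d i) with h | h <;> rw [h] at hi
  · have := Real.exp_le_exp.2 hi.le
    have := Real.exp_pos (-d i)
    linarith
  · have := Real.exp_le_exp.2 hi.le
    have := Real.exp_pos (d i)
    linarith

theorem IsHermitian.sum_trace_exp_add_le [Nonempty n] {ι : Type*} [Fintype ι] {q : ι → ℝ}
    (hq : ∀ i, 0 ≤ q i) {X : ι → Matrix n n ℝ} (hX : ∀ i, (X i).IsHermitian) {H W : Matrix n n ℝ}
    (hH : H.IsHermitian) (hW : (1 + W - ∑ i, q i • NormedSpace.exp (X i)).PosSemidef) :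
    ∑ i, q i * trace (NormedSpace.exp (H + X i)) ≤ trace (NormedSpace.exp H * (1 + W)) := by
  have hE : (NormedSpace.exp H).PosSemidef := by
    obtain ⟨U, d, rfl⟩ := hH.exists_eq_unitary_mul_diagonal
    rw [exp_unitary_mul_diagonal]
    exact PosSemidef.unitary_mul_diagonal U fun i => (Real.exp_pos _).le
  have h := hE.trace_mul_nonneg hW
  rw [mul_sub, trace_sub, Finset.mul_sum, trace_sum] at h
  refine le_trans (Finset.sum_le_sum fun i _ => ?_) (sub_nonneg.1 h)
  rw [Matrix.mul_smul, trace_smul, smul_eq_mul]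
  exact mul_le_mul_of_nonneg_left (hH.trace_exp_add_le (hX i)) (hq i)

/-- One step of the matrix Laplace-transform method for the potential `tr (e^H + e^(-H) - 2)`. -/
theorem IsHermitian.sum_trace_exp_add_exp_neg_le [Nonempty n] {ι : Type*} [Fintype ι] {q : ι → ℝ}
    (hq : ∀ i, 0 ≤ q i) (hq1 : ∑ i, q i = 1) {X : ι → Matrix n n ℝ}
    (hX : ∀ i, (X i).IsHermitian) {H W : Matrix n n ℝ} (hH : H.IsHermitian) {v : ℝ}
    (hWp : (1 + W - ∑ i, q i • NormedSpace.exp (X i)).PosSemidef)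
    (hWn : (1 + W - ∑ i, q i • NormedSpace.exp (-X i)).PosSemidef)
    (hv : (v • 1 - W).PosSemidef) :
    ∑ i, q i * trace (NormedSpace.exp (H + X i) + NormedSpace.exp (-(H + X i)) - 2) ≤
      (1 + v) * trace (NormedSpace.exp H + NormedSpace.exp (-H) - 2) + 2 * trace W := by
  have h1 := IsHermitian.sum_trace_exp_add_le hq hX hH hWp
  have h2 := IsHermitian.sum_trace_exp_add_le hq (fun i => (hX i).neg) hH.neg hWn
  have h3 := hH.posSemidef_exp_add_exp_neg_sub_two.trace_mul_nonneg hv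
  have e : ∑ i, q i * trace (NormedSpace.exp (H + X i) + NormedSpace.exp (-(H + X i)) - 2) =
      ∑ i, q i * trace (NormedSpace.exp (H + X i)) +
      ∑ i, q i * trace (NormedSpace.exp (-H + -X i)) - trace (2 : Matrix n n ℝ) := by
    simp only [trace_sub, trace_add, mul_sub, mul_add, Finset.sum_sub_distrib,
      Finset.sum_add_distrib, ← Finset.sum_mul, hq1, one_mul, neg_add]
  have e2 : trace ((2 : Matrix n n ℝ) * W) = 2 * trace W := by
    rw [two_mul, trace_add, two_mul]
  rw [e]
  simp only [mul_sub, mul_add, sub_mul, add_mul, mul_one, trace_sub, trace_add, Matrix.mul_smul,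
    trace_smul, smul_eq_mul, e2] at h1 h2 h3 ⊢
  linarith

theorem sum_prod_mul_trace_exp_le [Nonempty n] {ι : Type*} [Fintype ι] {q : ι → ℝ}
    (hq : ∀ i, 0 ≤ q i) (hq1 : ∑ i, q i = 1) {X : ι → Matrix n n ℝ}
    (hX : ∀ i, (X i).IsHermitian) {W : Matrix n n ℝ} {v : ℝ} (hv0 : 0 ≤ v)
    (hWp : (1 + W - ∑ i, q i • NormedSpace.exp (X i)).PosSemidef)
    (hWn : (1 + W - ∑ i, q i • NormedSpace.exp (-X i)).PosSemidef)
    (hv : (v • 1 - W).PosSemidef) (k : ℕ) :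
    v * ∑ ω : Fin k → ι, (∏ t, q (ω t)) *
      trace (NormedSpace.exp (∑ t, X (ω t)) + NormedSpace.exp (-∑ t, X (ω t)) - 2) ≤
      2 * trace W * ((1 + v) ^ k - 1) := by
  induction k with
  | zero => simp [NormedSpace.exp_zero, one_add_one_eq_two]
  | succ k ih =>
    set Φ : Matrix n n ℝ → ℝ := fun H => trace (NormedSpace.exp H + NormedSpace.exp (-H) - 2)
      with hΦ
    have hsum : ∑ ω : Fin k → ι, ∏ t, q (ω t) = 1 := by
      rw [← Fintype.sum_pow, hq1, one_pow]
    have hstep : ∑ ω : Fin (k + 1) → ι, (∏ t, q (ω t)) * Φ (∑ t, X (ω t)) ≤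
        ∑ ω : Fin k → ι, (∏ t, q (ω t)) * ((1 + v) * Φ (∑ t, X (ω t)) + 2 * trace W) := by
      rw [← (Fin.snocEquiv fun _ => ι).sum_comp, Fintype.sum_prod_type_right]
      refine Finset.sum_le_sum fun ω _ => ?_
      have h := IsHermitian.sum_trace_exp_add_exp_neg_le hq hq1 hX (H := ∑ t, X (ω t))
        (isSelfAdjoint_sum _ fun t _ => hX (ω t)) hWp hWn hv
      refine le_trans (le_of_eq ?_) (mul_le_mul_of_nonneg_left h
        (Finset.prod_nonneg fun t _ => hq (ω t)))
      rw [Finset.mul_sum]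
      refine Finset.sum_congr rfl fun i _ => ?_
      simp only [Fin.snocEquiv_apply, Fin.prod_univ_castSucc, Fin.sum_univ_castSucc,
        Fin.snoc_castSucc, Fin.snoc_last, hΦ, mul_assoc]
    calc _ ≤ _ := mul_le_mul_of_nonneg_left hstep hv0
      _ = (1 + v) * (v * ∑ ω : Fin k → ι, (∏ t, q (ω t)) * Φ (∑ t, X (ω t))) +
          2 * trace W * v := by
        simp only [mul_add, Finset.sum_add_distrib, ← Finset.sum_mul, hsum]
        simp only [Finset.mul_sum, one_mul, mul_comm v (2 * _)]
        congr 1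
        exact Finset.sum_congr rfl fun _ _ => by ring
      _ ≤ (1 + v) * (2 * trace W * ((1 + v) ^ k - 1)) + 2 * trace W * v := by gcongr
      _ = _ := by ring

theorem posSemidef_one_add_sub_sum_exp {ι : Type*} [Fintype ι] {q : ι → ℝ} (hq : ∀ i, 0 ≤ q i)
    (hq1 : ∑ i, q i = 1) {X : ι → Matrix n n ℝ} (hX : ∀ i, (X i).IsHermitian)
    (hX0 : ∑ i, q i • X i = 0) (hX1 : ∀ i, (1 - X i).PosSemidef) {W : Matrix n n ℝ}
    (hW : (W - ∑ i, q i • X i ^ 2).PosSemidef) :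
    (1 + W - ∑ i, q i • NormedSpace.exp (X i)).PosSemidef := by
  have e : 1 + W - ∑ i, q i • NormedSpace.exp (X i) =
      (W - ∑ i, q i • X i ^ 2) + ∑ i, q i • (1 + X i + X i ^ 2 - NormedSpace.exp (X i)) := by
    simp only [smul_sub, smul_add, Finset.sum_sub_distrib, Finset.sum_add_distrib, hX0,
      ← Finset.sum_smul, hq1, one_smul]
    abel
  rw [e]
  exact hW.add (posSemidef_sum _ fun i _ =>
    ((hX i).posSemidef_one_add_add_sq_sub_exp (hX1 i)).smul (hq i))

open scoped Matrix.Norms.L2Operator in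
/-- A matrix Chernoff bound with intrinsic dimension: `tr S` replaces the ambient dimension. -/
theorem sum_prod_mul_exp_le_trace [Nonempty n] {ι : Type*} [Fintype ι] {q : ι → ℝ}
    (hq : ∀ i, 0 ≤ q i) (hq1 : ∑ i, q i = 1) {Y : ι → Matrix n n ℝ} {S : Matrix n n ℝ}
    (hS : S = ∑ i, q i • Y i) (hS1 : (1 - S).PosSemidef) {M ε : ℝ} (hM : 0 < M)
    (hε : 0 < ε) (hε1 : ε < 1) (hY : ∀ i, (Y i).PosSemidef)
    (hYM : ∀ i, (M • 1 - Y i).PosSemidef) (hY2 : ∀ i, (M • Y i - Y i ^ 2).PosSemidef) (c : ℕ)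
    [DecidablePred fun ω : Fin c → ι => c * ε < ‖∑ t, (Y (ω t) - S)‖] :
    (∑ ω : Fin c → ι with c * ε < ‖∑ t, (Y (ω t) - S)‖, ∏ t, q (ω t)) *
      (Real.exp (2 * (c * ε ^ 2 / (4 * M))) - 2) ≤
      2 * trace S * Real.exp (c * ε ^ 2 / (4 * M)) := by
  set θ := ε / (2 * M) with hθ
  have hθ0 : 0 < θ := by positivity
  have hθM : θ * M ≤ 1 := by rw [hθ]; field_simp; linarith
  have hSp : S.PosSemidef := hS ▸ posSemidef_sum _ fun i _ => (hY i).smul (hq i)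
  have hSM : (M • 1 - S).PosSemidef := by
    have e : M • 1 - S = ∑ i, q i • (M • 1 - Y i) := by
      simp only [smul_sub, Finset.sum_sub_distrib, ← Finset.sum_smul, hq1, one_smul, ← hS]
    rw [e]
    exact posSemidef_sum _ fun i _ => (hYM i).smul (hq i)
  have hX : ∀ i, (θ • (Y i - S)).IsHermitian := fun i =>
    ((hY i).1.sub hSp.1).smul (IsSelfAdjoint.all _)
  have hX0 : ∑ i, q i • θ • (Y i - S) = 0 := by
    simp only [smul_comm _ θ, ← Finset.smul_sum, smul_sub, Finset.sum_sub_distrib,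
      ← Finset.sum_smul, hq1, one_smul, ← hS, sub_self]
  have h1 : ((1 - θ * M) • (1 : Matrix n n ℝ)).PosSemidef :=
    PosSemidef.one.smul (sub_nonneg.2 hθM)
  have hW : ((θ ^ 2 * M) • S - ∑ i, q i • (θ • (Y i - S)) ^ 2).PosSemidef := by
    have e : (θ ^ 2 * M) • S - ∑ i, q i • (θ • (Y i - S)) ^ 2 =
        θ ^ 2 • (∑ i, q i • (M • Y i - Y i ^ 2) + S ^ 2) := by
      have e1 : ∑ i, q i • (Y i - S) ^ 2 = ∑ i, q i • Y i ^ 2 - S ^ 2 := by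
        have e2 : ∀ i, (Y i - S) ^ 2 = Y i ^ 2 - Y i * S - S * Y i + S ^ 2 := fun i => by
          noncomm_ring
        have e3 : ∑ i, q i • (Y i * S) = S * S := by
          simp only [← Matrix.smul_mul, ← Finset.sum_mul, ← hS]
        have e4 : ∑ i, q i • (S * Y i) = S * S := by
          simp only [← Matrix.mul_smul, ← Finset.mul_sum, ← hS]
        simp only [e2, smul_sub, smul_add, Finset.sum_sub_distrib, Finset.sum_add_distrib,
          ← Finset.sum_smul, hq1, one_smul, e3, e4]
        noncomm_ring
      have e5 : ∑ i, q i • (θ • (Y i - S)) ^ 2 = θ ^ 2 • ∑ i, q i • (Y i - S) ^ 2 := by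
        rw [Finset.smul_sum]
        exact Finset.sum_congr rfl fun i _ => by rw [smul_pow, smul_comm]
      have e6 : ∑ i, q i • M • Y i = M • S := by
        rw [hS, Finset.smul_sum]
        exact Finset.sum_congr rfl fun i _ => smul_comm _ _ _
      rw [e5, e1]
      simp only [smul_sub, Finset.sum_sub_distrib, e6, mul_smul, smul_add]
      abel
    rw [e]
    exact ((posSemidef_sum _ fun i _ => (hY2 i).smul (hq i)).add (hSp.pow 2)).smul (by positivity)
  have hWp := posSemidef_one_add_sub_sum_exp hq hq1 hX hX0 (fun i => by
    have e : 1 - θ • (Y i - S) = (1 - θ * M) • 1 + θ • (M • 1 - Y i) + θ • S := by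
      module
    rw [e]
    exact (h1.add ((hYM i).smul hθ0.le)).add (hSp.smul hθ0.le)) hW
  have hWn := posSemidef_one_add_sub_sum_exp hq hq1 (fun i => (hX i).neg)
    (by simpa only [smul_neg, Finset.sum_neg_distrib, neg_eq_zero] using hX0) (fun i => by
    have e : 1 - -(θ • (Y i - S)) = (1 - θ * M) • 1 + θ • (M • 1 - S) + θ • Y i := by
      module
    rw [e]
    exact (h1.add (hSM.smul hθ0.le)).add ((hY i).smul hθ0.le)) (by simpa only [neg_sq] using hW)
  have hv : ((θ ^ 2 * M) • 1 - (θ ^ 2 * M) • S).PosSemidef := by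
    rw [← smul_sub]
    exact hS1.smul (by positivity)
  have hv0 : 0 < θ ^ 2 * M := by positivity
  have key := sum_prod_mul_trace_exp_le hq hq1 hX hv0.le hWp hWn hv c
  have hu : c * (θ ^ 2 * M) = c * ε ^ 2 / (4 * M) := by rw [hθ]; field_simp; ring
  have hu2 : θ * (c * ε) = 2 * (c * ε ^ 2 / (4 * M)) := by rw [hθ]; field_simp; ring
  rw [trace_smul, smul_eq_mul] at key
  have key' : ∑ ω : Fin c → ι, (∏ t, q (ω t)) *
      trace (NormedSpace.exp (∑ t, θ • (Y (ω t) - S)) +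
        NormedSpace.exp (-∑ t, θ • (Y (ω t) - S)) - 2) ≤
      2 * trace S * ((1 + θ ^ 2 * M) ^ c - 1) := by
    refine le_of_mul_le_mul_left (key.trans_eq ?_) hv0
    ring
  have hH : ∀ ω : Fin c → ι, (∑ t, θ • (Y (ω t) - S)).IsHermitian := fun ω =>
    isSelfAdjoint_sum _ fun t _ => hX (ω t)
  have hprod : ∀ ω : Fin c → ι, 0 ≤ ∏ t, q (ω t) := fun ω => Finset.prod_nonneg fun t _ => hq _
  have hpow : (1 + θ ^ 2 * M) ^ c ≤ Real.exp (c * ε ^ 2 / (4 * M)) := by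
    rw [← hu, Real.exp_nat_mul]
    gcongr
    rw [add_comm]
    exact Real.add_one_le_exp _
  calc _ = ∑ ω : Fin c → ι with c * ε < ‖∑ t, (Y (ω t) - S)‖, (∏ t, q (ω t)) *
        (Real.exp (2 * (c * ε ^ 2 / (4 * M))) - 2) := Finset.sum_mul _ _ _
    _ ≤ ∑ ω : Fin c → ι with c * ε < ‖∑ t, (Y (ω t) - S)‖, (∏ t, q (ω t)) *
        trace (NormedSpace.exp (∑ t, θ • (Y (ω t) - S)) +
          NormedSpace.exp (-∑ t, θ • (Y (ω t) - S)) - 2) := by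
      refine Finset.sum_le_sum fun ω hω => mul_le_mul_of_nonneg_left ?_ (hprod ω)
      refine (hH ω).exp_sub_two_le_trace (by positivity) ?_
      rw [← Finset.smul_sum, norm_smul, Real.norm_of_nonneg hθ0.le, ← hu2]
      exact mul_lt_mul_of_pos_left (Finset.mem_filter.1 hω).2 hθ0
    _ ≤ _ := Finset.sum_le_sum_of_subset_of_nonneg (Finset.filter_subset _ _) fun ω _ _ =>
      mul_nonneg (hprod ω) (hH ω).posSemidef_exp_add_exp_neg_sub_two.trace_nonneg
    _ ≤ _ := key'
    _ ≤ _ := by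
      have := hSp.trace_nonneg
      gcongr
      linarith

theorem posSemidef_smul_one_sub_vecMulVec {x : n → ℝ} {M : ℝ} (hx : x ⬝ᵥ x ≤ M) :
    (M • 1 - vecMulVec x x).PosSemidef := by
  refine PosSemidef.of_dotProduct_mulVec_nonneg
    ((isHermitian_one.smul (IsSelfAdjoint.all _)).sub (posSemidef_vecMulVec_self x).1) fun y => ?_
  have e : star y ⬝ᵥ (M • 1 - vecMulVec x x) *ᵥ y = M * (y ⬝ᵥ y) - (x ⬝ᵥ y) ^ 2 := by
    rw [star_trivial, sub_mulVec, smul_mulVec, one_mulVec, vecMulVec_mulVec, dotProduct_sub,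
      dotProduct_smul, smul_eq_mul, op_smul_eq_smul, dotProduct_smul, smul_eq_mul,
      dotProduct_comm y x, pow_two]
  have hcs : (x ⬝ᵥ y) ^ 2 ≤ (x ⬝ᵥ x) * (y ⬝ᵥ y) := by
    simpa only [dotProduct, ← pow_two] using Finset.sum_mul_sq_le_sq_mul_sq Finset.univ x y
  have hy : 0 ≤ y ⬝ᵥ y := by simpa using dotProduct_star_self_nonneg y
  rw [e]
  nlinarith

theorem posSemidef_smul_vecMulVec_sub_sq {x : n → ℝ} {M : ℝ} (hx : x ⬝ᵥ x ≤ M) :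
    (M • vecMulVec x x - vecMulVec x x ^ 2).PosSemidef := by
  have e : M • vecMulVec x x - vecMulVec x x ^ 2 = (M - x ⬝ᵥ x) • vecMulVec x x := by
    rw [pow_two, vecMulVec_mul_vecMulVec, vecMulVec_smul, sub_smul]
  rw [e]
  exact (posSemidef_vecMulVec_self x).smul (sub_nonneg.2 hx)

open scoped Matrix.Norms.L2Operator in
theorem posSemidef_one_sub_of_norm_le_one {S : Matrix n n ℝ} (hS : S.IsHermitian)
    (h : ‖S‖ ≤ 1) : (1 - S).PosSemidef := by
  refine PosSemidef.of_dotProduct_mulVec_nonneg (isHermitian_one.sub hS) fun y => ?_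
  set z : EuclideanSpace ℝ n := WithLp.toLp 2 y
  have h1 : y ⬝ᵥ S *ᵥ y ≤ ‖z‖ * ‖toEuclideanCLM (n := n) (𝕜 := ℝ) S z‖ := by
    have := real_inner_le_norm z (toEuclideanCLM (n := n) (𝕜 := ℝ) S z)
    rwa [inner_toEuclideanCLM] at this
  have h2 : ‖toEuclideanCLM (n := n) (𝕜 := ℝ) S z‖ ≤ ‖z‖ :=
    ((toEuclideanCLM (n := n) (𝕜 := ℝ) S).le_opNorm z).trans
      (mul_le_of_le_one_left (norm_nonneg _) h)
  have h3 : y ⬝ᵥ y = ‖z‖ ^ 2 := by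
    rw [EuclideanSpace.real_norm_sq_eq]
    simp [dotProduct, z, pow_two]
  rw [star_trivial, sub_mulVec, one_mulVec, dotProduct_sub, h3]
  nlinarith [norm_nonneg z]

end Matrix

open scoped Matrix.Norms.L2Operator in
theorem specNorm_eq_norm {m n : ℕ} (M : Matrix (Fin m) (Fin n) ℝ) : specNorm M = ‖M‖ :=
  rfl

theorem frobNorm_sq {m n : ℕ} (M : Matrix (Fin m) (Fin n) ℝ) :
    frobNorm M ^ 2 = ∑ i, ∑ j, M i j ^ 2 :=
  Real.sq_sqrt (by positivity)

theorem vecNorm_sq {m : ℕ} (v : Fin m → ℝ) : vecNorm v ^ 2 = ∑ i, v i ^ 2 :=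
  Real.sq_sqrt (by positivity)

theorem le_of_mul_exp_sub_two_le {P F M ε δ c : ℝ} (hP : 0 ≤ P) (hFM : F ≤ M) (hM : 1 / 24 ≤ M)
    (hε : 0 < ε) (hε1 : ε < 1) (hδ : 0 < δ) (hδ1 : δ < 1)
    (hc : 96 * M / ε ^ 2 * Real.log (96 * M / (ε ^ 2 * √δ)) ≤ c)
    (h : P * (Real.exp (2 * (c * ε ^ 2 / (4 * M))) - 2) ≤
      2 * F * Real.exp (c * ε ^ 2 / (4 * M))) : P ≤ δ := by
  have hM0 : 0 < M := by linarith
  have hs : 0 < √δ := Real.sqrt_pos.2 hδ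
  have hs1 : √δ < 1 := by rw [Real.sqrt_lt' one_pos]; simpa using hδ1
  have hss : √δ * √δ = δ := Real.mul_self_sqrt hδ.le
  set L := 96 * M / (ε ^ 2 * √δ) with hL
  have hL1 : 96 * M / √δ ≤ L := by
    rw [hL]
    gcongr
    exact mul_le_of_le_one_left hs.le (pow_le_one₀ hε.le hε1.le)
  have hL2 : 4 / √δ ≤ 96 * M / √δ := by
    gcongr
    linarith
  have hL3 : 4 ≤ 4 / √δ := by
    rw [le_div_iff₀ hs]
    linarith
  have hL4 : 4 ≤ L := by linarith
  set u := c * ε ^ 2 / (4 * M) with hu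
  have hu1 : 2 * Real.log L ≤ u := by
    have h1 : 96 * M / ε ^ 2 * Real.log L * (ε ^ 2 / (4 * M)) ≤ c * (ε ^ 2 / (4 * M)) := by
      gcongr
    have e1 : 96 * M / ε ^ 2 * Real.log L * (ε ^ 2 / (4 * M)) = 24 * Real.log L := by
      field_simp
      ring
    have e2 : c * (ε ^ 2 / (4 * M)) = u := by rw [hu]; ring
    have := Real.log_nonneg (by linarith : 1 ≤ L)
    linarith
  have hE : L * L ≤ Real.exp u := by
    have h1 := Real.exp_le_exp.2 hu1
    rwa [two_mul, Real.exp_add, Real.exp_log (by linarith)] at h1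
  have hLL : 384 * M ≤ L * L * δ := by
    have h1 : (96 * M / √δ) * (4 / √δ) ≤ L * L :=
      mul_le_mul hL1 (hL2.trans hL1) (by positivity) (by linarith)
    rw [div_mul_div_comm, hss, div_le_iff₀ hδ] at h1
    linarith
  set E := Real.exp u
  have hE2 : Real.exp (2 * u) = E * E := by rw [two_mul, Real.exp_add]
  rw [hE2] at h
  have hE4 : 16 ≤ E := by nlinarith
  have h1 : P * (E * E / 2) ≤ P * (E * E - 2) := by
    gcongr
    nlinarith
  have h2 : P * E ≤ 4 * M := by
    have h3 : P * E / 2 * E ≤ 2 * M * E := by nlinarith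
    have := le_of_mul_le_mul_right h3 (by linarith)
    linarith
  have h3 : P * E ≤ δ * E := by nlinarith
  exact le_of_mul_le_mul_right h3 (by linarith)

/-- The normalized columns whose outer products are averaged by `Csample`. -/
noncomputable def scaledColumn {m n : ℕ} (A : Matrix (Fin m) (Fin n) ℝ) (q : Fin n → ℝ)
    (i : Fin n) : Fin m → ℝ :=
  fun j => A j i / √(q i)

theorem vecMulVec_scaledColumn_apply {m n : ℕ} (A : Matrix (Fin m) (Fin n) ℝ) {q : Fin n → ℝ}
    (hq : ∀ i, 0 < q i) (i : Fin n) (j k : Fin m) :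
    vecMulVec (scaledColumn A q i) (scaledColumn A q i) j k = A j i * A k i / q i := by
  rw [vecMulVec_apply, scaledColumn, scaledColumn, div_mul_div_comm, Real.mul_self_sqrt (hq i).le]

theorem mul_transpose_eq_sum_smul {m n : ℕ} (A : Matrix (Fin m) (Fin n) ℝ) {q : Fin n → ℝ}
    (hq : ∀ i, 0 < q i) :
    A * Aᵀ = ∑ i, q i • vecMulVec (scaledColumn A q i) (scaledColumn A q i) := by
  ext j k
  rw [mul_apply, Matrix.sum_apply]
  refine Finset.sum_congr rfl fun i _ => ?_
  rw [Matrix.smul_apply, vecMulVec_scaledColumn_apply A hq, transpose_apply, smul_eq_mul,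
    mul_div_cancel₀ _ (hq i).ne']

theorem Csample_mul_transpose {m n c : ℕ} (A : Matrix (Fin m) (Fin n) ℝ) {q : Fin n → ℝ}
    (hq : ∀ i, 0 < q i) (ω : Fin c → Fin n) :
    Csample A q ω * (Csample A q ω)ᵀ =
      (c : ℝ)⁻¹ • ∑ t, vecMulVec (scaledColumn A q (ω t)) (scaledColumn A q (ω t)) := by
  ext j k
  rw [mul_apply, Matrix.smul_apply, Matrix.sum_apply, smul_eq_mul, Finset.mul_sum]
  refine Finset.sum_congr rfl fun t _ => ?_
  have := (hq (ω t)).le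
  rw [vecMulVec_scaledColumn_apply A hq, transpose_apply, Csample, of_apply, of_apply,
    div_mul_div_comm, Real.mul_self_sqrt (by positivity), ← div_div, div_eq_inv_mul _ (c : ℝ),
    mul_div_assoc]

theorem scaledColumn_dotProduct_self_le {m n : ℕ} (A : Matrix (Fin m) (Fin n) ℝ) {q : Fin n → ℝ}
    (hq : ∀ i, 0 < q i) {β : ℝ} (hβ : 0 < β) (hF : 0 < frobNorm A ^ 2) (i : Fin n)
    (h : β * vecNorm (fun j => A j i) ^ 2 / frobNorm A ^ 2 ≤ q i) :
    scaledColumn A q i ⬝ᵥ scaledColumn A q i ≤ frobNorm A ^ 2 / β := by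
  have e : scaledColumn A q i ⬝ᵥ scaledColumn A q i = vecNorm (fun j => A j i) ^ 2 / q i := by
    rw [vecNorm_sq, Finset.sum_div, dotProduct]
    refine Finset.sum_congr rfl fun j _ => ?_
    rw [scaledColumn, div_mul_div_comm, Real.mul_self_sqrt (hq i).le, pow_two]
  rw [div_le_iff₀ hF] at h
  rw [e, div_le_div_iff₀ (hq i) hβ]
  linarith

theorem measure_pi_finset {n c : ℕ} {q : Fin n → ℝ} (hq : ∀ i, 0 < q i) (ν : Measure (Fin n))
    [IsProbabilityMeasure ν] (hν : ∀ i, ν {i} = ENNReal.ofReal (q i))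
    (s : Finset (Fin c → Fin n)) :
    Measure.pi (fun _ => ν) (s : Set (Fin c → Fin n)) =
      ENNReal.ofReal (∑ ω ∈ s, ∏ t, q (ω t)) := by
  rw [← sum_measure_singleton,
    ENNReal.ofReal_sum_of_nonneg fun ω _ => Finset.prod_nonneg fun t _ => (hq _).le]
  refine Finset.sum_congr rfl fun ω _ => ?_
  rw [Measure.pi_singleton, ENNReal.ofReal_prod_of_nonneg fun t _ => (hq _).le]
  simp only [hν]

open scoped Matrix.Norms.L2Operator in
theorem stmt_10 {m n c : ℕ} (hm : 0 < m) (hn : 0 < n) (hc : 0 < c)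
    (A : Matrix (Fin m) (Fin n) ℝ)
    (q : Fin n → ℝ) (hq : ∀ i, 0 < q i) (hq1 : ∑ i, q i = 1)
    (ν : Measure (Fin n)) [IsProbabilityMeasure ν]
    (hν : ∀ i, ν {i} = ENNReal.ofReal (q i))
    (μ : Measure (Fin c → Fin n)) (hμ : μ = Measure.pi fun _ => ν)
    (hA2 : specNorm A ≤ 1) (hAF : frobNorm A ^ 2 ≥ 1 / 24)
    (β : ℝ) (hβ : β ∈ Set.Ioc (0 : ℝ) 1)
    (ε : ℝ) (hε : ε ∈ Set.Ioo (0 : ℝ) 1)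
    (δ : ℝ) (hδ : δ ∈ Set.Ioo (0 : ℝ) 1)
    (hprob : ∀ i, q i ≥ β * vecNorm (fun j => A j i) ^ 2 / frobNorm A ^ 2)
    (hcbound : (c : ℝ) ≥ (96 * frobNorm A ^ 2 / (β * ε ^ 2)) *
        Real.log (96 * frobNorm A ^ 2 / (β * ε ^ 2 * Real.sqrt δ))) :
    μ {ω | specNorm (A * Aᵀ - Csample A q ω * (Csample A q ω)ᵀ) ≤ ε}
      ≥ ENNReal.ofReal (1 - δ) := by
  classical
  obtain ⟨hβ0, hβ1⟩ := hβ
  have : Nonempty (Fin m) := ⟨⟨0, hm⟩⟩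
  have hF : 0 < frobNorm A ^ 2 := by linarith
  have hc0 : (0 : ℝ) < c := Nat.cast_pos.2 hc
  set S := A * Aᵀ with hSdef
  set Y : Fin n → Matrix (Fin m) (Fin m) ℝ := fun i =>
    vecMulVec (scaledColumn A q i) (scaledColumn A q i)
  set M := frobNorm A ^ 2 / β with hMdef
  have hFM : frobNorm A ^ 2 ≤ M := le_div_self hF.le hβ0 hβ1
  have hx := fun i => scaledColumn_dotProduct_self_le A hq hβ0 hF i (hprob i)
  have htr : trace S = frobNorm A ^ 2 := by
    rw [frobNorm_sq]
    simp only [hSdef, trace, diag_apply, mul_apply, transpose_apply, pow_two]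
  have hS1 : (1 - S).PosSemidef := by
    refine posSemidef_one_sub_of_norm_le_one (isHermitian_mul_conjTranspose_self A) ?_
    have h := l2_opNorm_conjTranspose_mul_self Aᴴ
    rw [conjTranspose_conjTranspose, l2_opNorm_conjTranspose, ← specNorm_eq_norm A] at h
    exact h.trans_le (mul_le_one₀ hA2 (norm_nonneg _) hA2)
  have key := sum_prod_mul_exp_le_trace (fun i => (hq i).le) hq1
    (mul_transpose_eq_sum_smul A hq) hS1 (hF.trans_le hFM) hε.1 hε.2
    (fun i => posSemidef_vecMulVec_self (scaledColumn A q i))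
    (fun i => posSemidef_smul_one_sub_vecMulVec (hx i))
    (fun i => posSemidef_smul_vecMulVec_sub_sq (hx i)) c
  set B : Finset (Fin c → Fin n) := {ω | c * ε < ‖∑ t, (Y (ω t) - S)‖} with hB
  have hgood : {ω | specNorm (S - Csample A q ω * (Csample A q ω)ᵀ) ≤ ε} =
      (B : Set (Fin c → Fin n))ᶜ := by
    ext ω
    have e : ∑ t, (Y (ω t) - S) = -((c : ℝ) • (S - Csample A q ω * (Csample A q ω)ᵀ)) := by
      rw [Csample_mul_transpose A hq, smul_sub, smul_smul, mul_inv_cancel₀ hc0.ne', one_smul,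
        neg_sub, Finset.sum_sub_distrib, Finset.sum_const, Finset.card_univ, Fintype.card_fin,
        Nat.cast_smul_eq_nsmul]
    rw [Set.mem_ofPred_eq, Set.mem_compl_iff, Finset.mem_coe, hB, Finset.mem_filter_univ, not_lt, e,
      norm_neg, norm_smul, Real.norm_of_nonneg hc0.le, mul_le_mul_iff_right₀ hc0, specNorm_eq_norm]
  have hP : ∑ ω ∈ B, ∏ t, q (ω t) ≤ δ := by
    refine le_of_mul_exp_sub_two_le
      (Finset.sum_nonneg fun ω _ => Finset.prod_nonneg fun t _ => (hq _).le) hFM (by linarith)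
      hε.1 hε.2 hδ.1 hδ.2 (le_of_eq_of_le ?_ hcbound) (htr ▸ key)
    have e1 : 96 * M / ε ^ 2 = 96 * frobNorm A ^ 2 / (β * ε ^ 2) := by
      rw [hMdef]; field_simp
    have e2 : 96 * M / (ε ^ 2 * √δ) = 96 * frobNorm A ^ 2 / (β * ε ^ 2 * √δ) := by
      rw [← div_div, e1, div_div]
    rw [e1, e2]
  rw [hgood, hμ, prob_compl_eq_one_sub B.measurableSet, measure_pi_finset hq ν hν,
    ENNReal.ofReal_sub _ hδ.1.le, ENNReal.ofReal_one]
  exact tsub_le_tsub_left (ENNReal.ofReal_le_ofReal hP) 1
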